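/- Fix a, ρ, λ, μ with ρ > 0, μ > 0, λ + 2μ > 0, a > 0, take the perfectly bonded case Z_S = Z_T with Z defined by the lumped formula, and define the immovable-sphere Faxén force coefficients Λ_L(ω) = 4πa(λ+2μ) e^{−ika} (Z+Z_M)/(Z_L+Z_M) (longitudinal incidence) and Λ_T(ω) = 4πaμ e^{−iha} (Z+Z_M)/(Z_T+Z_M) (transverse incidence), as functions of ω > 0. Then both coefficients have the same quasistatic limit: lim_{ω→0⁺} Λ_L(ω) = lim_{ω→0⁺} Λ_T(ω) = 12πaμ/(2 + κ^{−2}), where κ^{−2} = μ/(λ+2μ). (Hence the quasistatic force on a rigid immovable bonded sphere from plane wave incidence is F_p = (12πaμ/(2+κ^{−2})) u₀ for either wave type, u₀ being the incident displacement at the sphere center.) -/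

import Mathlib

open Complex Filter Topology

/-- Mass-like impedance `Z_M = iω(4/3)πa³ρ`. -/
noncomputable def ZMf (a ρ ω : ℝ) : ℂ := I * ω * (4 / 3) * Real.pi * a ^ 3 * ρ

/-- Longitudinal impedance `Z_L = (iω)⁻¹ 4πa(λ+2μ)(1−ika)`, `k = ω/c_L`. -/
noncomputable def ZLf (a ρ lam mu ω : ℝ) : ℂ :=
  (I * ω)⁻¹ * (4 * Real.pi * a * (lam + 2 * mu))
    * (1 - I * (ω / Real.sqrt ((lam + 2 * mu) / ρ)) * a)

/-- Transverse impedance `Z_T = (iω)⁻¹ 4πaμ(1−iha)`, `h = ω/c_T`. -/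
noncomputable def ZTf (a ρ mu ω : ℝ) : ℂ :=
  (I * ω)⁻¹ * (4 * Real.pi * a * mu) * (1 - I * (ω / Real.sqrt (mu / ρ)) * a)

/-- The sphere impedance `Z` given by the lumped formula
`3/(Z+Z_M) = 1/(Z_L+Z_M) + 2/(Z_S+Z_M)`. -/
noncomputable def Zsphere (ZM ZL ZS : ℂ) : ℂ :=
  3 / (1 / (ZL + ZM) + 2 / (ZS + ZM)) - ZM

/-- Faxén force coefficient of a rigid immovable bonded sphere for longitudinal
incidence: `Λ_L = 4πa(λ+2μ) e^{−ika}(Z+Z_M)/(Z_L+Z_M)`. -/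
noncomputable def LamL (a ρ lam mu ω : ℝ) : ℂ :=
  (4 * Real.pi * a * (lam + 2 * mu) : ℝ)
    * Complex.exp (-(I * (ω / Real.sqrt ((lam + 2 * mu) / ρ)) * a))
    * ((Zsphere (ZMf a ρ ω) (ZLf a ρ lam mu ω) (ZTf a ρ mu ω) + ZMf a ρ ω)
        / (ZLf a ρ lam mu ω + ZMf a ρ ω))

/-- Faxén force coefficient of a rigid immovable bonded sphere for transverse
incidence: `Λ_T = 4πaμ e^{−iha}(Z+Z_M)/(Z_T+Z_M)`. -/
noncomputable def LamT (a ρ lam mu ω : ℝ) : ℂ :=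
  (4 * Real.pi * a * mu : ℝ)
    * Complex.exp (-(I * (ω / Real.sqrt (mu / ρ)) * a))
    * ((Zsphere (ZMf a ρ ω) (ZLf a ρ lam mu ω) (ZTf a ρ mu ω) + ZMf a ρ ω)
        / (ZTf a ρ mu ω + ZMf a ρ ω))

/-- Rescaling all impedances by a common nonzero factor. -/
lemma faxen_scale (w P Q R M : ℂ) (hw : w ≠ 0) (X Y V : ℂ) (hX : X + M = w⁻¹ * P)
    (hY : Y + M = w⁻¹ * Q) (hV : V + M = w⁻¹ * R) :
    (Zsphere M X Y + M) / (V + M) = 3 / (1 / P + 2 / Q) / R := by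
  unfold Zsphere
  rw [sub_add_cancel, hX, hY, hV]
  have h : 1 / (w⁻¹ * P) + 2 / (w⁻¹ * Q) = w * (1 / P + 2 / Q) := by
    simp only [div_eq_mul_inv, mul_inv, inv_inv]; ring
  rw [h]
  simp only [div_eq_mul_inv, mul_inv, inv_inv]
  have h2 : w⁻¹ * w = 1 := inv_mul_cancel₀ hw
  linear_combination (3 * (1 * P⁻¹ + 2 * Q⁻¹)⁻¹ * R⁻¹) * h2

/-- Regularised impedance `iω(Z+Z_M)`. -/
noncomputable def regZ (a ρ m ω : ℝ) : ℂ :=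
  (4 * Real.pi * a * m) * (1 - I * (ω / Real.sqrt (m / ρ)) * a)
    + (I * ω) * ZMf a ρ ω

lemma regZ_tendsto (a ρ m : ℝ) :
    Tendsto (fun ω : ℝ => regZ a ρ m ω) (𝓝[>] 0) (𝓝 (4 * Real.pi * a * m : ℂ)) := by
  have h : Continuous (fun ω : ℝ => regZ a ρ m ω) := by
    unfold regZ ZMf
    simp only [div_eq_mul_inv]
    fun_prop
  have h2 := (h.tendsto 0).mono_left (nhdsWithin_le_nhds (s := Set.Ioi 0))
  simpa [regZ, ZMf] using h2

lemma phase_tendsto (a c : ℝ) :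
    Tendsto (fun ω : ℝ => Complex.exp (-(I * (ω / c) * a))) (𝓝[>] 0) (𝓝 1) := by
  have h : Continuous (fun ω : ℝ => Complex.exp (-(I * (ω / c) * a))) := by
    simp only [div_eq_mul_inv]
    fun_prop
  have h2 := (h.tendsto 0).mono_left (nhdsWithin_le_nhds (s := Set.Ioi 0))
  simpa using h2

/-- Quasistatic plane-wave force on a rigid immovable bonded sphere, Eq. (-19) of
the paper: both Faxén force coefficients tend to `12πaμ/(2+κ⁻²)` as `ω → 0⁺`,
where `κ⁻² = μ/(λ+2μ)`. -/
theorem quasistatic_faxen_force (a ρ lam mu : ℝ)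
    (ha : 0 < a) (hρ : 0 < ρ) (hmu : 0 < mu) (hlam : 0 < lam + 2 * mu) :
    Tendsto (fun ω : ℝ => LamL a ρ lam mu ω) (𝓝[>] 0)
      (𝓝 ((12 * Real.pi * a * mu : ℝ) / (2 + (mu / (lam + 2 * mu) : ℝ)))) ∧
    Tendsto (fun ω : ℝ => LamT a ρ lam mu ω) (𝓝[>] 0)
      (𝓝 ((12 * Real.pi * a * mu : ℝ) / (2 + (mu / (lam + 2 * mu) : ℝ)))) := by
  have hpi := Real.pi_pos
  have eL : ∀ ω : ℝ, 0 < ω → ZLf a ρ lam mu ω + ZMf a ρ ω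
      = (I * ω)⁻¹ * regZ a ρ (lam + 2 * mu) ω := by
    intro ω hω
    have hw : (I * ω : ℂ) ≠ 0 := mul_ne_zero I_ne_zero (by exact_mod_cast hω.ne')
    unfold ZLf regZ
    rw [mul_add (I * (ω : ℂ))⁻¹, inv_mul_cancel_left₀ hw]
    push_cast
    ring
  have eT : ∀ ω : ℝ, 0 < ω → ZTf a ρ mu ω + ZMf a ρ ω
      = (I * ω)⁻¹ * regZ a ρ mu ω := by
    intro ω hω
    have hw : (I * ω : ℂ) ≠ 0 := mul_ne_zero I_ne_zero (by exact_mod_cast hω.ne')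
    unfold ZTf regZ
    rw [mul_add (I * (ω : ℂ))⁻¹, inv_mul_cancel_left₀ hw]
    ring
  have hA : (4 * Real.pi * a * (lam + 2 * mu : ℝ) : ℂ) ≠ 0 := by
    exact_mod_cast (by positivity : 4 * Real.pi * a * (lam + 2 * mu) ≠ 0)
  have hB : (4 * Real.pi * a * mu : ℂ) ≠ 0 := by
    exact_mod_cast (by positivity : 4 * Real.pi * a * mu ≠ 0)
  have hS : (1 / (4 * Real.pi * a * (lam + 2 * mu : ℝ)) + 2 / (4 * Real.pi * a * mu) : ℂ) ≠ 0 := by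
    exact_mod_cast (by positivity :
      1 / (4 * Real.pi * a * (lam + 2 * mu)) + 2 / (4 * Real.pi * a * mu) ≠ 0)
  have hP := regZ_tendsto a ρ (lam + 2 * mu)
  have hQ := regZ_tendsto a ρ mu
  have hZ := (tendsto_const_nhds (x := (3 : ℂ))).div
    (((tendsto_const_nhds (x := (1 : ℂ))).div hP hA).add
      ((tendsto_const_nhds (x := (2 : ℂ))).div hQ hB)) hS
  have hlim : (3 : ℂ) / (1 / (4 * Real.pi * a * (lam + 2 * mu : ℝ)) + 2 / (4 * Real.pi * a * mu))
      = (12 * Real.pi * a * mu : ℝ) / (2 + (mu / (lam + 2 * mu) : ℝ)) := by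
    have : (3 : ℝ) / (1 / (4 * Real.pi * a * (lam + 2 * mu)) + 2 / (4 * Real.pi * a * mu))
      = (12 * Real.pi * a * mu : ℝ) / (2 + (mu / (lam + 2 * mu) : ℝ)) := by
      generalize lam + 2 * mu = m at *
      field_simp
      ring
    exact_mod_cast this
  constructor
  · have h := ((tendsto_const_nhds (x := ((4 * Real.pi * a * (lam + 2 * mu) : ℝ) : ℂ))).mul
      (phase_tendsto a (Real.sqrt ((lam + 2 * mu) / ρ)))).mul (hZ.div hP hA)
    rw [hlim] at h
    have e : ((4 * Real.pi * a * (lam + 2 * mu) : ℝ) : ℂ)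
        = 4 * Real.pi * a * (lam + 2 * mu : ℝ) := by push_cast; ring
    rw [e, mul_one, mul_div_cancel₀ _ hA] at h
    refine h.congr' ?_
    filter_upwards [self_mem_nhdsWithin] with ω hω
    have hω : 0 < ω := hω
    have hw : (I * ω : ℂ) ≠ 0 := mul_ne_zero I_ne_zero (by exact_mod_cast hω.ne')
    unfold LamL
    rw [faxen_scale _ _ _ _ _ hw _ _ _ (eL ω hω) (eT ω hω) (eL ω hω), e]
    rfl
  · have h := ((tendsto_const_nhds (x := ((4 * Real.pi * a * mu : ℝ) : ℂ))).mul
      (phase_tendsto a (Real.sqrt (mu / ρ)))).mul (hZ.div hQ hB)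
    rw [hlim] at h
    have e : ((4 * Real.pi * a * mu : ℝ) : ℂ) = 4 * Real.pi * a * mu := by push_cast; ring
    rw [e, mul_one, mul_div_cancel₀ _ hB] at h
    refine h.congr' ?_
    filter_upwards [self_mem_nhdsWithin] with ω hω
    have hω : 0 < ω := hω
    have hw : (I * ω : ℂ) ≠ 0 := mul_ne_zero I_ne_zero (by exact_mod_cast hω.ne')
    unfold LamT
    rw [faxen_scale _ _ _ _ _ hw _ _ _ (eL ω hω) (eT ω hω) (eT ω hω), e]
    rfl
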